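/- For every integer $n \geq 5$, one has $2^{n/2} \mu_{K_n}\left(\frac{n}{\sqrt{2}}\right) < (n-1)^n$, where $\mu_{K_n}(z) = \sum_{k=0}^{\lfloor n/2 \rfloor} (-1)^k \frac{n!}{2^k k! (n-2k)!} z^{n-2k}$ is the matching polynomial of the complete graph. -/

import Mathlib

open Finset

/-- The value at `x / 2` of the physicists' Hermite polynomial of degree `m`. -/
noncomputable def physHermite (x : ℝ) : ℕ → ℝ
  | 0 => 1
  | 1 => x
  | m + 2 => x * physHermite x (m + 1) - 2 * (m + 1) * physHermite x m

/-- The `k`-th term of the explicit formula for `physHermite x m`, zero for `m < 2 * k`. -/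
noncomputable def physHermiteTerm (x : ℝ) (m k : ℕ) : ℝ :=
  (-1) ^ k * m.choose (2 * k) * ((2 * k).factorial / k.factorial) * x ^ (m - 2 * k)

lemma physHermiteTerm_eq_zero (x : ℝ) {m k : ℕ} (h : m < 2 * k) : physHermiteTerm x m k = 0 := by
  simp [physHermiteTerm, Nat.choose_eq_zero_of_lt h]

lemma physHermiteTerm_succ_zero (x : ℝ) (m : ℕ) :
    physHermiteTerm x (m + 1) 0 = x * physHermiteTerm x m 0 := by
  simp [physHermiteTerm, pow_succ']

lemma physHermiteTerm_add_two_succ (x : ℝ) (m k : ℕ) :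
    physHermiteTerm x (m + 2) (k + 1) =
      x * physHermiteTerm x (m + 1) (k + 1) - 2 * (m + 1) * physHermiteTerm x m k := by
  have hpascal : ((m + 2).choose (2 * k + 2) : ℝ)
      = (m + 1).choose (2 * k + 1) + (m + 1).choose (2 * k + 2) := by
    exact_mod_cast Nat.choose_succ_succ (m + 1) (2 * k + 1)
  have habsorb : ((m : ℝ) + 1) * m.choose (2 * k)
      = (m + 1).choose (2 * k + 1) * (2 * k + 1) := by
    exact_mod_cast Nat.add_one_mul_choose_eq m (2 * k)
  have hfact : ((2 * k + 2).factorial / (k + 1).factorial : ℝ)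
      = 2 * (2 * k + 1) * ((2 * k).factorial / k.factorial) := by
    have : (k.factorial : ℝ) ≠ 0 := by positivity
    rw [Nat.factorial_succ, Nat.factorial_succ, Nat.factorial_succ k]
    push_cast
    field_simp
    ring
  have hpow : ((m + 1).choose (2 * k + 2) : ℝ) * x ^ (m - 2 * k)
      = (m + 1).choose (2 * k + 2) * (x * x ^ (m + 1 - (2 * k + 2))) := by
    rcases lt_or_ge (m + 1) (2 * k + 2) with h | h
    · simp [Nat.choose_eq_zero_of_lt h]
    · rw [← pow_succ', show m + 1 - (2 * k + 2) + 1 = m - 2 * k by omega]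
  simp only [physHermiteTerm, mul_add, mul_one, hpascal, hfact,
    show m + 2 - (2 * k + 2) = m - 2 * k by omega, pow_succ (-1 : ℝ) k]
  linear_combination (-(-1 : ℝ) ^ k * (2 * (2 * k + 1) * ((2 * k).factorial / k.factorial))) * hpow
    + (2 * (-1 : ℝ) ^ k * ((2 * k).factorial / k.factorial) * x ^ (m - 2 * k)) * habsorb

lemma sum_physHermiteTerm (x : ℝ) (m N : ℕ) (h : m < 2 * N) :
    ∑ k ∈ range N, physHermiteTerm x m k = physHermite x m := by
  induction m using Nat.strong_induction_on generalizing N with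
  | _ m ih =>
  obtain ⟨N, rfl⟩ : ∃ M, N = M + 1 := ⟨N - 1, by omega⟩
  match m with
  | 0 | 1 =>
    rw [sum_range_succ', sum_eq_zero fun k _ => physHermiteTerm_eq_zero x (by omega)]
    simp [physHermiteTerm, physHermite]
  | m + 2 =>
    rw [physHermite, ← ih (m + 1) (by omega) (N + 1) (by omega), ← ih m (by omega) N (by omega),
      sum_range_succ', sum_range_succ', physHermiteTerm_succ_zero]
    simp only [physHermiteTerm_add_two_succ, sum_sub_distrib, ← mul_sum]
    ring

lemma two_rpow_mul_sum_eq_physHermite (x : ℝ) (n : ℕ) :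
    (2 : ℝ) ^ ((n : ℝ) / 2)
        * ∑ k ∈ range (n / 2 + 1),
            (-1) ^ k * (n.factorial : ℝ)
              / (2 ^ k * k.factorial * (n - 2 * k).factorial)
              * (x / Real.sqrt 2) ^ (n - 2 * k)
      = physHermite x n := by
  have hs : (2 : ℝ) ^ ((n : ℝ) / 2) = Real.sqrt 2 ^ n := by
    rw [Real.sqrt_eq_rpow, ← Real.rpow_natCast, ← Real.rpow_mul (by norm_num)]
    congr 1
    ring
  rw [← sum_physHermiteTerm x n (n / 2 + 1) (by omega), hs, mul_sum]
  refine sum_congr rfl fun k hk => ?_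
  have hk' : 2 * k ≤ n := by
    have := mem_range.1 hk
    omega
  have hsplit : Real.sqrt 2 ^ n = 2 ^ k * Real.sqrt 2 ^ (n - 2 * k) := by
    conv_lhs => rw [← Nat.add_sub_of_le hk', pow_add, pow_mul, Real.sq_sqrt (by norm_num)]
  have h0 : Real.sqrt 2 ≠ 0 := by positivity
  rw [physHermiteTerm, Nat.cast_choose ℝ hk', hsplit, div_pow]
  field_simp

lemma physHermite_growth {n : ℕ} (hn : 8 ≤ n) {m : ℕ} (hm : m ≤ n) :
    0 < physHermite n m ∧ (n : ℝ) / 2 * physHermite n m ≤ physHermite n (m + 1) := by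
  have hn' : (8 : ℝ) ≤ n := by exact_mod_cast hn
  induction m with
  | zero => simp only [physHermite]; constructor <;> linarith
  | succ m ih =>
    obtain ⟨hpos, hle⟩ := ih (by omega)
    have hm' : (m : ℝ) + 1 ≤ n := by exact_mod_cast hm
    refine ⟨lt_of_lt_of_le (by positivity) hle, ?_⟩
    rw [physHermite]
    have h1 : 2 * ((m : ℝ) + 1) * physHermite n m ≤ 2 * n * physHermite n m := by gcongr
    have h2 : 8 * physHermite n m ≤ n * physHermite n m := by gcongr
    nlinarith

lemma physHermite_succ_le {n : ℕ} (hn : 8 ≤ n) {m : ℕ} (hm : m ≤ n) :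
    physHermite n (m + 1) ≤ (n - 2 * m / n) * physHermite n m := by
  have hn' : (0 : ℝ) < n := by exact_mod_cast (by omega : 0 < n)
  cases m with
  | zero => simp [physHermite]
  | succ m =>
    have h : physHermite n (m + 1) ≤ n * physHermite n m := by
      cases m with
      | zero => simp [physHermite]
      | succ m =>
        have := (physHermite_growth hn (m := m) (by omega)).1
        rw [physHermite]
        linarith [mul_pos (show (0 : ℝ) < 2 * (m + 1) by positivity) this]
    have h' : physHermite n (m + 1) / n ≤ physHermite n m := by
      rwa [div_le_iff₀' hn']
    rw [physHermite]
    push_cast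
    have := mul_le_mul_of_nonneg_left h' (show (0 : ℝ) ≤ 2 * (m + 1) by positivity)
    linear_combination this

lemma physHermite_succ_le' {n : ℕ} (hn : 8 ≤ n) {m : ℕ} (hm : m ≤ n) :
    physHermite n (m + 1)
      ≤ (n - 2 * m / n - 4 * m * (m - 1) / n ^ 3) * physHermite n m := by
  have hn' : (0 : ℝ) < n := by exact_mod_cast (by omega : 0 < n)
  cases m with
  | zero => simp [physHermite]
  | succ m =>
    have hpos := (physHermite_growth hn (m := m) (by omega)).1
    have h := physHermite_succ_le hn (m := m) (by omega)
    have h' : (1 / n + 2 * m / n ^ 3) * physHermite n (m + 1) ≤ physHermite n m := by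
      calc (1 / n + 2 * m / n ^ 3) * physHermite n (m + 1)
          ≤ (1 / n + 2 * m / n ^ 3) * ((n - 2 * m / n) * physHermite n m) := by gcongr
        _ = (1 - (2 * m / n ^ 2) ^ 2) * physHermite n m := by field_simp; ring
        _ ≤ 1 * physHermite n m := by gcongr; linarith [sq_nonneg (2 * (m : ℝ) / n ^ 2)]
        _ = physHermite n m := one_mul _
    rw [physHermite]
    push_cast
    have := mul_le_mul_of_nonneg_left h' (show (0 : ℝ) ≤ 2 * (m + 1) by positivity)
    linear_combination this

lemma physHermite_le_exp {n : ℕ} (hn : 8 ≤ n) {m : ℕ} (hm : m ≤ n) :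
    physHermite n m ≤ ((n : ℝ) - 1) ^ m *
      Real.exp ((m - m * (m - 1) / n - 4 * m * (m - 1) * (m - 2) / (3 * n ^ 3)) / (n - 1)) := by
  have hn' : (8 : ℝ) ≤ n := by exact_mod_cast hn
  have hn1 : (0 : ℝ) < n - 1 := by linarith
  induction m with
  | zero => simp [physHermite]
  | succ m ih =>
    have hpos := (physHermite_growth hn (m := m) (by omega)).1
    set b : ℝ := 1 - 2 * m / n - 4 * m * (m - 1) / n ^ 3 with hb
    have hratio : (n : ℝ) - 2 * m / n - 4 * m * (m - 1) / n ^ 3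
        ≤ (n - 1) * Real.exp (b / (n - 1)) := by
      have := mul_le_mul_of_nonneg_left (Real.add_one_le_exp (b / (n - 1))) hn1.le
      rw [mul_add, mul_div_cancel₀ _ hn1.ne'] at this
      linarith
    calc physHermite n (m + 1)
        ≤ (n - 2 * m / n - 4 * m * (m - 1) / n ^ 3) * physHermite n m :=
          physHermite_succ_le' hn (by omega)
      _ ≤ (n - 1) * Real.exp (b / (n - 1)) * physHermite n m := by gcongr
      _ ≤ (n - 1) * Real.exp (b / (n - 1)) * _ :=
          mul_le_mul_of_nonneg_left (ih (by omega)) (by positivity)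
      _ = _ := by
        rw [pow_succ' ((n : ℝ) - 1) m, mul_mul_mul_comm, ← Real.exp_add, ← add_div]
        congr 3
        rw [hb]
        push_cast
        field_simp
        ring

theorem matchingPoly_complete_lt (n : ℕ) (hn : 5 ≤ n) :
    (2 : ℝ) ^ ((n : ℝ) / 2)
        * ∑ k ∈ range (n / 2 + 1),
            (-1) ^ k * (n.factorial : ℝ)
              / (2 ^ k * k.factorial * (n - 2 * k).factorial)
              * ((n : ℝ) / Real.sqrt 2) ^ (n - 2 * k)
      < ((n : ℝ) - 1) ^ n := by
  rw [two_rpow_mul_sum_eq_physHermite]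
  rcases lt_or_ge n 12 with h | h
  · interval_cases n <;> norm_num [physHermite]
  have hn' : (12 : ℝ) ≤ n := by exact_mod_cast h
  have hn1 : (0 : ℝ) < n - 1 := by linarith
  refine (physHermite_le_exp (by omega) le_rfl).trans_lt ?_
  refine mul_lt_of_lt_one_right (by positivity) (Real.exp_lt_one_iff.2 (div_neg_of_neg_of_pos ?_ hn1))
  have hexponent : (n : ℝ) - n * (n - 1) / n - 4 * n * (n - 1) * (n - 2) / (3 * n ^ 3)
      = -((n * (n - 12) + 8) / (3 * n ^ 2)) := by
    field_simp
    ring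
  rw [hexponent, neg_lt_zero]
  have : 0 ≤ (n : ℝ) - 12 := by linarith
  positivity
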